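/- Let α ∈ ℝ and let A be an α-maximal monotone operator on H whose domain D(A) has nonempty interior in H. Then there exist h₀ ∈ H and constants r₀, a₁, a₂ > 0 such that r₀|y| ≤ (y, x − h₀) + a₁|x|² + a₂ for all (x,y) ∈ A. (This is condition (H₁-ii) in the case X = H, where ‖·‖_{X*} coincides with the H-norm.) -/

import Mathlib

open MeasureTheory Set Filter
open scoped RealInnerProductSpace Topology NNReal

noncomputable section

variable {H : Type*} [NormedAddCommGroup H] [InnerProductSpace ℝ H] [CompleteSpace H]
variable {X : Type*} [NormedAddCommGroup X] [NormedSpace ℝ X]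

/-- The dual norm `‖y‖_{X*} = sup { ⟪y, j x⟫ : ‖x‖_X ≤ 1 }` of `y ∈ H`, relative to the
embedding `j : X → H`. -/
def dualNorm (j : X →L[ℝ] H) (y : H) : ℝ :=
  sSup ((fun x : X => ⟪y, j x⟫) '' {x : X | ‖x‖ ≤ 1})

/-- The set of all partition variation sums of `g` on `[0,T]`, with increments measured
by the gauge `N`. -/
def varSums (N : H → ℝ) (g : ℝ → H) (T : ℝ) : Set ℝ :=
  { v | ∃ m : ℕ, ∃ t : Fin (m + 1) → ℝ, Monotone t ∧ t 0 = 0 ∧ t (Fin.last m) = T ∧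
      v = ∑ i : Fin m, N (g (t i.succ) - g (t i.castSucc)) }

/-- `g` has bounded variation on `[0,T]` w.r.t. the gauge `N`. -/
def HasBV (N : H → ℝ) (g : ℝ → H) (T : ℝ) : Prop := BddAbove (varSums N g T)

/-- The total variation (BV norm) of `g` on `[0,T]` w.r.t. the gauge `N`. -/
def bvNorm (N : H → ℝ) (g : ℝ → H) (T : ℝ) : ℝ := sSup (varSums N g T)

/-- A multivalued operator `A ⊆ H × H` is monotone. -/
def IsMonotoneOp (A : Set (H × H)) : Prop :=
  ∀ p ∈ A, ∀ q ∈ A, 0 ≤ ⟪p.2 - q.2, p.1 - q.1⟫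

/-- A multivalued operator `A ⊆ H × H` is maximal monotone. -/
def IsMaximalMonotone (A : Set (H × H)) : Prop :=
  IsMonotoneOp A ∧ ∀ u v : H, (∀ p ∈ A, 0 ≤ ⟪v - p.2, u - p.1⟫) → (u, v) ∈ A

/-- The operator `A + αI`. -/
def addAlphaI (A : Set (H × H)) (α : ℝ) : Set (H × H) :=
  (fun p : H × H => (p.1, p.2 + α • p.1)) '' A

/-- The domain `D(A)` of a multivalued operator. -/
def opDom (A : Set (H × H)) : Set H := {x | ∃ y, (x, y) ∈ A}

/-- Hypothesis (H₁): `A` is `α`-maximal monotone and satisfies the coercivity-type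
inequality with constants `h₀, r₀, a₁, a₂`. -/
def HypH1 (A : Set (H × H)) (j : X →L[ℝ] H) (α : ℝ) (h₀ : H) (r₀ a₁ a₂ : ℝ) : Prop :=
  IsMaximalMonotone (addAlphaI A α) ∧ 0 < r₀ ∧ 0 < a₁ ∧ 0 < a₂ ∧
    ∀ p ∈ A, r₀ * dualNorm j p.2 ≤ ⟪p.2, p.1 - h₀⟫ + a₁ * ‖p.1‖ ^ 2 + a₂

/-- `f ∈ W^{1,1}([0,T];H)`. -/
def MemW11 (f : ℝ → H) (T : ℝ) : Prop :=
  ∃ f' : ℝ → H, IntegrableOn f' (Icc 0 T) ∧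
    ∀ t ∈ Icc (0:ℝ) T, f t = f 0 + ∫ s in (0:ℝ)..t, f' s

/-- `g ∈ W^{2,1}([0,T];H)`. -/
def MemW21 (g : ℝ → H) (T : ℝ) : Prop :=
  ∃ g' : ℝ → H, MemW11 g' T ∧ ∀ t ∈ Icc (0:ℝ) T, g t = g 0 + ∫ s in (0:ℝ)..t, g' s

/-- `(u,η) = GD(A;u₀,f,M)`: generalized deterministic solution of
`du + Au(dt) ∋ f dt + dM`, `u(0) = u₀`, on `[0,T]`. -/
def IsGDSolution (A : Set (H × H)) (j : X →L[ℝ] H) (T : ℝ)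
    (u₀ : H) (f : ℝ → H) (M : ℝ → X) (u η : ℝ → H) : Prop :=
  -- (d₁)
  (ContinuousOn u (Icc 0 T) ∧ (∀ t ∈ Icc (0:ℝ) T, u t ∈ closure (opDom A)) ∧ u 0 = u₀) ∧
  -- (d₂)
  (ContinuousOn η (Icc 0 T) ∧ η 0 = 0 ∧ HasBV (dualNorm j) η T) ∧
  -- (d₃)
  (∀ t ∈ Icc (0:ℝ) T, u t + η t = u₀ + (∫ s in (0:ℝ)..t, f s) + j (M t)) ∧
  -- (d₄)
  ∃ (u0s : ℕ → H) (fs : ℕ → ℝ → H) (Ms : ℕ → ℝ → X) (us hs : ℕ → ℝ → H),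
    (∀ n, u0s n ∈ opDom A) ∧
    (∀ n, MemW11 (fs n) T) ∧
    (∀ n, ContinuousOn (Ms n) (Icc 0 T) ∧ Ms n 0 = 0 ∧ MemW21 (fun t => j (Ms n t)) T) ∧
    (∀ n, ∃ L : ℝ≥0, LipschitzOnWith L (us n) (Icc 0 T)) ∧
    (∀ n, AEStronglyMeasurable (hs n) (volume.restrict (Ioc 0 T)) ∧
          ∃ C : ℝ, ∀ᵐ s ∂(volume.restrict (Ioc (0:ℝ) T)), ‖hs n s‖ ≤ C) ∧
    (∀ n, ∀ᵐ s ∂(volume.restrict (Ioc (0:ℝ) T)), (us n s, hs n s) ∈ A) ∧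
    (∀ n, ∀ t ∈ Icc (0:ℝ) T,
        us n t + (∫ s in (0:ℝ)..t, hs n s) =
          u0s n + (∫ s in (0:ℝ)..t, fs n s) + j (Ms n t)) ∧
    Tendsto u0s atTop (𝓝 u₀) ∧
    Tendsto (fun n => ∫ s in Icc (0:ℝ) T, ‖fs n s - f s‖) atTop (𝓝 0) ∧
    TendstoUniformlyOn Ms M atTop (Icc 0 T) ∧
    TendstoUniformlyOn us u atTop (Icc 0 T) ∧
    TendstoUniformlyOn (fun n t => ∫ s in (0:ℝ)..t, hs n s) η atTop (Icc 0 T) ∧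
    ∃ C : ℝ, ∀ n, ∀ v ∈ varSums (dualNorm j) (fun t => ∫ s in (0:ℝ)..t, hs n s) T, v ≤ C

end

/-- Baire category: if countably many closed sets cover a nonempty open set of a Baire space,
then one of them has nonempty interior. -/
theorem IsOpen.exists_interior_nonempty_of_subset_iUnion {Y ι : Type*} [TopologicalSpace Y]
    [BaireSpace Y] [Countable ι] {U : Set Y} (hU : IsOpen U) (hne : U.Nonempty) {f : ι → Set Y}
    (hf : ∀ i, IsClosed (f i)) (hcov : U ⊆ ⋃ i, f i) : ∃ i, (interior (f i)).Nonempty := by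
  have hd : Dense (⋃ i, interior (f i ∪ Uᶜ)) := by
    refine dense_iUnion_interior_of_closed (fun i => (hf i).union hU.isClosed_compl) ?_
    refine eq_univ_of_forall fun x => ?_
    by_cases hx : x ∈ U
    · obtain ⟨i, hi⟩ := mem_iUnion.1 (hcov hx)
      exact mem_iUnion.2 ⟨i, Or.inl hi⟩
    · obtain ⟨i, -⟩ := mem_iUnion.1 (hcov hne.some_mem)
      exact mem_iUnion.2 ⟨i, Or.inr hx⟩
  obtain ⟨x, hxU, hx⟩ := hd.inter_open_nonempty U hU hne
  obtain ⟨i, hi⟩ := mem_iUnion.1 hx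
  refine ⟨i, x, mem_interior.2 ⟨interior (f i ∪ Uᶜ) ∩ U, ?_, isOpen_interior.inter hU, hi, hxU⟩⟩
  rintro z ⟨hz, hzU⟩
  exact (interior_subset hz).resolve_right fun h => h hzU

/-- The points `w` at which all affine functions `⟪y, · - x⟫`, `(x, y) ∈ A`, are bounded by
`n * (1 + ‖x‖ ^ 2)`. -/
def growthSet {H : Type*} [NormedAddCommGroup H] [InnerProductSpace ℝ H]
    (A : Set (H × H)) (n : ℕ) : Set H :=
  {w | ∀ p ∈ A, ⟪p.2, w - p.1⟫ ≤ n * (1 + ‖p.1‖ ^ 2)}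

theorem isClosed_growthSet {H : Type*} [NormedAddCommGroup H] [InnerProductSpace ℝ H]
    (A : Set (H × H)) (n : ℕ) : IsClosed (growthSet A n) := by
  simp only [growthSet, ofPred_forall]
  exact isClosed_biInter fun p _ => isClosed_le (by fun_prop) continuous_const

theorem opDom_subset_iUnion_growthSet {H : Type*} [NormedAddCommGroup H] [InnerProductSpace ℝ H]
    {A : Set (H × H)} {α : ℝ} (hA : IsMonotoneOp (addAlphaI A α)) :
    opDom A ⊆ ⋃ n, growthSet A n := by
  rintro w ⟨v, hwv⟩
  obtain ⟨n, hn⟩ := exists_nat_ge (‖v‖ ^ 2 + (1 + 2 * |α|) * (1 + ‖w‖ ^ 2))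
  refine mem_iUnion.2 ⟨n, fun ⟨x, y⟩ hxy => ?_⟩
  have hmono : 0 ≤ ⟪(y + α • x) - (v + α • w), x - w⟫ :=
    hA _ (mem_image_of_mem _ hxy) _ (mem_image_of_mem _ hwv)
  have hsplit : ⟪(y + α • x) - (v + α • w), x - w⟫
      = ⟪v, w - x⟫ - ⟪y, w - x⟫ + α * ‖x - w‖ ^ 2 := by
    rw [show (y + α • x) - (v + α • w) = (y - v) + α • (x - w) by module, inner_add_left,
      real_inner_smul_left, real_inner_self_eq_norm_sq, ← neg_sub w x, inner_neg_right,
      inner_sub_left, norm_neg]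
    ring
  have hcs : ⟪v, w - x⟫ ≤ ‖v‖ * ‖x - w‖ := norm_sub_rev x w ▸ real_inner_le_norm v (w - x)
  have hsq : ‖x - w‖ ^ 2 ≤ 2 * ‖x‖ ^ 2 + 2 * ‖w‖ ^ 2 := by
    nlinarith [parallelogram_law_with_norm ℝ x w, sq_nonneg ‖x + w‖]
  have hα : α * ‖x - w‖ ^ 2 ≤ |α| * (2 * ‖x‖ ^ 2 + 2 * ‖w‖ ^ 2) :=
    mul_le_mul (le_abs_self α) hsq (sq_nonneg _) (abs_nonneg α)
  calc ⟪y, w - x⟫ ≤ ‖v‖ ^ 2 + (1 + 2 * |α|) * (‖x‖ ^ 2 + ‖w‖ ^ 2) := by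
        nlinarith [sq_nonneg (‖v‖ - ‖x - w‖), sq_nonneg ‖v‖]
    _ ≤ (‖v‖ ^ 2 + (1 + 2 * |α|) * (1 + ‖w‖ ^ 2)) * (1 + ‖x‖ ^ 2) := by
        have h₁ : 0 ≤ ‖v‖ ^ 2 * ‖x‖ ^ 2 := by positivity
        have h₂ : 0 ≤ (1 + 2 * |α|) * (1 + ‖w‖ ^ 2 * ‖x‖ ^ 2) := by positivity
        linarith
    _ ≤ n * (1 + ‖x‖ ^ 2) := by gcongr

theorem mul_norm_le_of_closedBall_subset_growthSet {H : Type*} [NormedAddCommGroup H]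
    [InnerProductSpace ℝ H] {A : Set (H × H)} {n : ℕ} {h : H} {r : ℝ} (hr : 0 ≤ r)
    (hball : Metric.closedBall h r ⊆ growthSet A n) {p : H × H} (hp : p ∈ A) :
    r * ‖p.2‖ ≤ ⟪p.2, p.1 - h⟫ + n * (1 + ‖p.1‖ ^ 2) := by
  obtain ⟨x, y⟩ := p
  have hmem : h + (r * ‖y‖⁻¹) • y ∈ Metric.closedBall h r := by
    rw [mem_closedBall_iff_norm, add_sub_cancel_left, norm_smul,
      Real.norm_of_nonneg (by positivity),
      mul_assoc]
    exact mul_le_of_le_one_right hr inv_mul_le_one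
  have hle : ⟪y, h + (r * ‖y‖⁻¹) • y - x⟫ ≤ n * (1 + ‖x‖ ^ 2) := hball hmem _ hp
  have hnorm : r * ‖y‖⁻¹ * ‖y‖ ^ 2 = r * ‖y‖ := by
    rcases eq_or_ne ‖y‖ 0 with h0 | h0
    · simp [h0]
    · field_simp
  rw [show h + (r * ‖y‖⁻¹) • y - x = (r * ‖y‖⁻¹) • y - (x - h) by abel, inner_sub_right,
    real_inner_smul_right, real_inner_self_eq_norm_sq, hnorm] at hle
  linarith

/-- **Theorem 2.2, (H₁-III) ⟹ (H₁-ii) with `X = H`.** An `α`-maximal monotone operator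
whose domain has nonempty interior satisfies the coercivity condition (H₁-ii) with the
`H`-norm in place of the dual norm. -/
theorem hypH1_of_nonempty_interior
    {H : Type*} [NormedAddCommGroup H] [InnerProductSpace ℝ H] [CompleteSpace H]
    [SecondCountableTopology H]
    (α : ℝ) (A : Set (H × H)) (hA : IsMaximalMonotone (addAlphaI A α))
    (hint : (interior (opDom A)).Nonempty) :
    ∃ (h₀ : H) (r₀ a₁ a₂ : ℝ), 0 < r₀ ∧ 0 < a₁ ∧ 0 < a₂ ∧
      ∀ p ∈ A, r₀ * ‖p.2‖ ≤ ⟪p.2, p.1 - h₀⟫ + a₁ * ‖p.1‖ ^ 2 + a₂ := by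
  obtain ⟨n, h₀, hh₀⟩ := isOpen_interior.exists_interior_nonempty_of_subset_iUnion hint
    (isClosed_growthSet A) (interior_subset.trans (opDom_subset_iUnion_growthSet hA.1))
  obtain ⟨r, hr, hball⟩ :=
    Metric.nhds_basis_closedBall.mem_iff.1 (mem_interior_iff_mem_nhds.1 hh₀)
  refine ⟨h₀, r, n + 1, n + 1, hr, by positivity, by positivity, fun p hp => ?_⟩
  have := mul_norm_le_of_closedBall_subset_growthSet hr.le hball hp
  nlinarith [sq_nonneg ‖p.1‖]
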